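/- For every real x with 0 < x < 1/4, the series Σ_{n≥1} o_n x^n converges and equals x/(1 − x^2·C(x)^2) = (1 − √(1−4x))/(3 − √(1−4x)), where o_n denotes the number of members of 𝓛_n containing an odd number of letters equal to 0. -/

import Mathlib

/-- A Catalan word: a word `a : Fin n → ℕ` satisfying (i) `a (i+1) ≥ a i - 1` for all
adjacent positions, and (ii) if `i` is the minimal index with `a i = k > 0`, then there
exist `i₁ < i < i₂` with `a i₁ = a i₂ = k - 1`. -/
def IsCatalanWord {n : ℕ} (a : Fin n → ℕ) : Prop :=
  (∀ (i : ℕ) (h : i + 1 < n), a ⟨i, Nat.lt_of_succ_lt h⟩ ≤ a ⟨i + 1, h⟩ + 1) ∧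
  (∀ i : Fin n, 0 < a i → (∀ j : Fin n, a j = a i → i ≤ j) →
    ((∃ i₁ : Fin n, i₁ < i ∧ a i₁ + 1 = a i) ∧ (∃ i₂ : Fin n, i < i₂ ∧ a i₂ + 1 = a i)))

/-- The number of letters of the word `a` equal to `c`. -/
noncomputable def countEq {n : ℕ} (a : Fin n → ℕ) (c : ℕ) : ℕ :=
  Set.ncard {i : Fin n | a i = c}

/-- `C(x) = (1 - √(1-4x))/(2x)`, the generating function of the Catalan numbers. -/
noncomputable def Cfun (x : ℝ) : ℝ := (1 - Real.sqrt (1 - 4*x)) / (2*x)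

/-- `oZ n` is the number of Catalan words of length `n` with an odd number of zeros. -/
noncomputable def oZ (n : ℕ) : ℕ :=
  Set.ncard {a : Fin n → ℕ | IsCatalanWord a ∧ Odd (countEq a 0)}

/-- Every letter is at most one larger than its successor. -/
abbrev NoDrop (l : List ℕ) : Prop := l.IsChain (fun p q => p ≤ q + 1)

/-- Catalan words as lists. -/
def IsCatalanList (l : List ℕ) : Prop :=
  NoDrop l ∧ ∀ k u v, l = u ++ (k + 1) :: v → k + 1 ∉ u → k ∈ u ∧ k ∈ v

/-- Delete the zeros of a word and decrease all other letters by one. -/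
def lower (l : List ℕ) : List ℕ := l.filterMap Nat.ppred

@[simp] theorem lower_nil : lower [] = [] := rfl

@[simp] theorem lower_zero_cons (l : List ℕ) : lower (0 :: l) = lower l := rfl

@[simp] theorem lower_succ_cons (k : ℕ) (l : List ℕ) : lower ((k + 1) :: l) = k :: lower l := rfl

@[simp] theorem lower_append (u v : List ℕ) : lower (u ++ v) = lower u ++ lower v :=
  List.filterMap_append

@[simp] theorem lower_replicate_zero (m : ℕ) : lower (List.replicate m 0) = [] := by
  induction m with
  | zero => rfl
  | succ m ih => simpa [List.replicate_succ] using ih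

@[simp] theorem lower_map_succ (b : List ℕ) : lower (b.map Nat.succ) = b := by
  induction b with
  | nil => rfl
  | cons h t ih => simp [ih]

@[simp] theorem count_zero_map_succ (b : List ℕ) : (b.map Nat.succ).count 0 = 0 := by
  simp [List.count_eq_zero]

theorem mem_lower {k : ℕ} {l : List ℕ} : k ∈ lower l ↔ k + 1 ∈ l := by
  induction l with
  | nil => simp
  | cons h t ih => cases h <;> simp [ih]

theorem length_eq_count_add_length_lower (l : List ℕ) :
    l.length = l.count 0 + (lower l).length := by
  induction l with
  | nil => rfl
  | cons h t ih => cases h <;> simp [ih] <;> omega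

theorem eq_map_succ_lower {l : List ℕ} (h : 0 ∉ l) : l = (lower l).map Nat.succ := by
  induction l with
  | nil => rfl
  | cons a t ih =>
    cases a with
    | zero => simp at h
    | succ a => simpa using ih (by simpa using h)

theorem eq_replicate_of_lower_eq_nil {l : List ℕ} (h : lower l = []) :
    l = List.replicate l.length 0 := by
  induction l with
  | nil => rfl
  | cons a t ih =>
    cases a with
    | zero => simpa [List.replicate_succ] using ih (by simpa using h)
    | succ a => simp at h

theorem lower_eq_append_cons {l u v : List ℕ} {k : ℕ} (h : lower l = u ++ k :: v) :
    ∃ u' v', l = u' ++ (k + 1) :: v' ∧ lower u' = u ∧ lower v' = v := by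
  induction l generalizing u with
  | nil => simp at h
  | cons a t ih =>
    cases a with
    | zero =>
      obtain ⟨u', v', rfl, h1, h2⟩ := ih (by simpa using h)
      exact ⟨0 :: u', v', rfl, by simpa using h1, h2⟩
    | succ a =>
      cases u with
      | nil =>
        simp only [lower_succ_cons, List.nil_append, List.cons.injEq] at h
        exact ⟨[], t, by simp [h.1], rfl, h.2⟩
      | cons b u =>
        simp only [lower_succ_cons, List.cons_append, List.cons.injEq] at h
        obtain ⟨u', v', rfl, h1, h2⟩ := ih h.2
        exact ⟨(a + 1) :: u', v', rfl, by simp [h.1, h1], h2⟩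

theorem NoDrop.lower {l : List ℕ} (h : NoDrop l) : NoDrop (lower l) := by
  induction l with
  | nil => simp
  | cons a t ih =>
    have ht := ih (List.isChain_cons.1 h).2
    cases a with
    | zero => simpa using ht
    | succ a =>
      rw [lower_succ_cons]
      refine List.isChain_cons.2 ⟨fun y hy => ?_, ht⟩
      rcases t with _ | ⟨b, t⟩
      · simp at hy
      · have hab := (List.isChain_cons_cons.1 h).1
        cases b with
        | zero => omega
        | succ b => simp at hy; omega

theorem noDrop_zero_cons {l : List ℕ} : NoDrop (0 :: l) ↔ NoDrop l := by
  simp [List.isChain_cons]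

theorem IsCatalanList.head_eq_zero {a : ℕ} {l : List ℕ} (h : IsCatalanList (a :: l)) : a = 0 := by
  cases a with
  | zero => rfl
  | succ a => simpa using (h.2 a [] l rfl (by simp)).1

theorem isCatalanList_nil : IsCatalanList [] := by
  simp [IsCatalanList]

theorem isCatalanList_zero_cons {l : List ℕ} :
    IsCatalanList (0 :: l) ↔ NoDrop l ∧ IsCatalanList (lower l) ∧
      (lower l = [] ∨ l ≠ List.replicate (l.count 0) 0 ++ (lower l).map Nat.succ) := by
  constructor
  · rintro ⟨h1, h2⟩
    have hl := noDrop_zero_cons.1 h1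
    have hc : IsCatalanList (lower l) := by
      refine ⟨hl.lower, fun k u v h hk => ?_⟩
      obtain ⟨u, v, rfl, rfl, rfl⟩ := lower_eq_append_cons h
      rw [mem_lower] at hk
      simpa [mem_lower] using h2 (k + 1) (0 :: u) v rfl (by simpa using hk)
    refine ⟨hl, hc, ?_⟩
    rw [or_iff_not_imp_left]
    intro hne heq
    obtain ⟨a, b, hab⟩ := List.exists_cons_of_ne_nil hne
    rw [hab] at hc
    obtain rfl := hc.head_eq_zero
    rw [hab] at heq
    have := (h2 0 (0 :: List.replicate (l.count 0) 0) (b.map Nat.succ)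
      (by rw [List.cons_append]; exact congrArg _ heq) (by simp)).2
    simp at this
  · rintro ⟨h1, h2, h3⟩
    refine ⟨noDrop_zero_cons.2 h1, fun k u v h hk => ?_⟩
    rcases u with _ | ⟨a, u⟩
    · simp at h
    simp only [List.cons_append, List.cons.injEq] at h
    obtain ⟨rfl, rfl⟩ := h
    have hku : k + 1 ∉ u := by simpa using hk
    have hlow : lower (u ++ (k + 1) :: v) = lower u ++ k :: lower v := by simp
    cases k with
    | succ k =>
      have := h2.2 k _ _ hlow (by rwa [mem_lower])
      simpa [mem_lower] using this
    | zero =>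
      refine ⟨by simp, ?_⟩
      by_contra hv
      have hu : lower u = [] := by
        rcases hlu : lower u with _ | ⟨a, b⟩
        · rfl
        · rw [hlow, hlu] at h2
          obtain rfl := h2.head_eq_zero
          exact absurd (mem_lower.1 (hlu ▸ List.mem_cons_self)) hku
      have hu' := eq_replicate_of_lower_eq_nil hu
      have hv' := eq_map_succ_lower hv
      rcases h3 with h3 | h3
      · simp at h3
      · apply h3
        rw [hu', hv']
        simp

/-- The words without a drop of more than one which lower to `b` and have `m` zeros. -/
def raises (b : List ℕ) (m : ℕ) : Set (List ℕ) := {l | NoDrop l ∧ lower l = b ∧ l.count 0 = m}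

theorem raises_zero {b : List ℕ} (hb : NoDrop b) : raises b 0 = {b.map Nat.succ} := by
  ext l
  simp only [raises, Set.mem_ofPred_eq, Set.mem_singleton_iff]
  constructor
  · rintro ⟨-, rfl, h⟩
    exact eq_map_succ_lower (List.count_eq_zero.1 h)
  · rintro rfl
    refine ⟨?_, by simp, by simp⟩
    rw [NoDrop, List.isChain_map]
    exact hb.imp (by intros; omega)

theorem raises_nil (m : ℕ) : raises [] m = {List.replicate m 0} := by
  ext l
  simp only [raises, Set.mem_ofPred_eq, Set.mem_singleton_iff]
  constructor
  · rintro ⟨-, h, rfl⟩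
    rw [eq_replicate_of_lower_eq_nil h]
    simp
  · rintro rfl
    refine ⟨?_, by simp, by simp⟩
    exact List.isChain_replicate_of_rel _ (by simp)

/-- The members of `raises b m` which do not start with a zero. -/
def raisesPos (b : List ℕ) (m : ℕ) : Set (List ℕ) := {l ∈ raises b m | l.head? ≠ some 0}

theorem encard_raises_succ (b : List ℕ) (m : ℕ) :
    (raises b (m + 1)).encard = (raises b m).encard + (raisesPos b (m + 1)).encard := by
  have h : raises b (m + 1) = (List.cons 0) '' raises b m ∪ raisesPos b (m + 1) := by
    ext l
    rcases l with _ | ⟨_ | a, l⟩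
    · simp [raises, raisesPos]
    · simp [raises, raisesPos, noDrop_zero_cons]
    · simp [raises, raisesPos]
  rw [h, Set.encard_union_eq, List.cons_injective.encard_image]
  rw [Set.disjoint_left]
  rintro _ ⟨l, -, rfl⟩ h
  exact h.2 rfl

theorem encard_raisesPos_zero_cons (b : List ℕ) (m : ℕ) :
    (raisesPos (0 :: b) m).encard = (raises b m).encard := by
  rw [← (List.cons_injective (a := 1)).encard_image (raises b m)]
  congr 1
  ext l
  rcases l with _ | ⟨_ | a, l⟩
  · simp [raises, raisesPos]
  · simp [raises, raisesPos]
  · cases a <;> simp [raises, raisesPos, List.isChain_cons]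

theorem encard_raisesPos_succ_cons {h : ℕ} {b : List ℕ} (hb : NoDrop ((h + 1) :: b)) (m : ℕ) :
    (raisesPos ((h + 1) :: b) m).encard = (raisesPos b m).encard := by
  rw [← (List.cons_injective (a := h + 2)).encard_image (raisesPos b m)]
  congr 1
  ext l
  constructor
  · rintro ⟨⟨h1, h2, h3⟩, h4⟩
    rcases l with _ | ⟨_ | a, l⟩
    · simp at h2
    · simp at h4
    · simp only [lower_succ_cons, List.cons.injEq] at h2
      obtain ⟨rfl, rfl⟩ := h2
      refine ⟨l, ⟨⟨(List.isChain_cons.1 h1).2, rfl, by simpa using h3⟩, fun h0 => ?_⟩, rfl⟩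
      have := (List.isChain_cons.1 h1).1 0 h0
      omega
  · rintro ⟨l, ⟨⟨h1, rfl, h3⟩, h4⟩, rfl⟩
    refine ⟨⟨List.isChain_cons.2 ⟨fun y hy => ?_, h1⟩, rfl, by simpa using h3⟩, by simp⟩
    rcases l with _ | ⟨_ | a, l⟩
    · simp at hy
    · simp at h4
    · have := (List.isChain_cons_cons.1 hb).1
      simp at hy
      omega

theorem encard_raises {b : List ℕ} (hb : NoDrop b) (m : ℕ) :
    (raises b m).encard = ((b.count 0 + 1).multichoose m : ℕ) := by
  induction b generalizing m with
  | nil => simp [raises_nil]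
  | cons h b ih =>
    have ih := ih (List.isChain_cons.1 hb).2
    induction m with
    | zero => simp [raises_zero hb]
    | succ m ihm =>
      rw [encard_raises_succ, ihm]
      cases h with
      | zero =>
        rw [encard_raisesPos_zero_cons, ih, List.count_cons_self,
          Nat.multichoose_succ_succ (b.count 0 + 1) m]
        push_cast
        ring
      | succ h =>
        rw [List.count_cons_of_ne (by simp)] at ihm ⊢
        rw [encard_raisesPos_succ_cons hb, ← ih m, ← encard_raises_succ, ih]

theorem replicate_append_mem_raises {b : List ℕ} (hb : NoDrop b) (m : ℕ) :
    List.replicate m 0 ++ b.map Nat.succ ∈ raises b m := by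
  induction m with
  | zero => simp [raises_zero hb]
  | succ m ih =>
    obtain ⟨h1, h2, h3⟩ := ih
    exact ⟨noDrop_zero_cons.2 h1, by simp, by simp⟩

theorem encard_isCatalanList_fiber {b : List ℕ} (hb : IsCatalanList b) (hne : b ≠ []) (m : ℕ) :
    {l | IsCatalanList l ∧ l.count 0 = m + 1 ∧ lower l = b}.encard + 1 =
      ((b.count 0 + 1).multichoose m : ℕ) := by
  rw [← encard_raises hb.1, ← Set.encard_sdiff_singleton_add_one
      (replicate_append_mem_raises hb.1 m),
    ← (List.cons_injective (a := 0)).encard_image (_ \ _)]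
  congr 2
  ext l
  constructor
  · rintro ⟨h1, h2, rfl⟩
    rcases l with _ | ⟨a, l⟩
    · simp at h2
    obtain rfl := h1.head_eq_zero
    obtain ⟨h4, h5, h6⟩ := isCatalanList_zero_cons.1 h1
    have hc : l.count 0 = m := by simpa using h2
    refine ⟨l, ⟨⟨h4, rfl, hc⟩, ?_⟩, rfl⟩
    subst hc
    exact h6.resolve_left hne
  · rintro ⟨l, ⟨⟨h1, rfl, rfl⟩, h3⟩, rfl⟩
    exact ⟨isCatalanList_zero_cons.2 ⟨h1, hb, Or.inr h3⟩, by simp, rfl⟩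

theorem isCatalanList_lower {l : List ℕ} (h : IsCatalanList l) : IsCatalanList (lower l) := by
  rcases l with _ | ⟨a, l⟩
  · exact h
  · obtain rfl := h.head_eq_zero
    exact (isCatalanList_zero_cons.1 h).2.1

theorem isCatalanList_replicate (n : ℕ) : IsCatalanList (List.replicate n 0) := by
  cases n with
  | zero => exact isCatalanList_nil
  | succ n =>
    rw [List.replicate_succ, isCatalanList_zero_cons]
    exact ⟨List.isChain_replicate_of_rel _ (by simp), by simpa using isCatalanList_nil, by simp⟩

theorem IsCatalanList.lt_length {l : List ℕ} (h : IsCatalanList l) {k : ℕ} (hk : k ∈ l) :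
    k < l.length := by
  have key : ∀ d, k - d ∈ l := by
    intro d
    induction d with
    | zero => exact hk
    | succ d ih =>
      rcases hd : k - d with _ | j
      · rwa [show k - (d + 1) = k - d by omega]
      · rw [hd] at ih
        obtain ⟨u, v, huv, hu⟩ := List.eq_append_cons_of_mem ih
        have := (h.2 j u v huv hu).1
        rw [huv, show k - (d + 1) = j by omega]
        exact List.mem_append_left _ this
  have : Finset.range (k + 1) ⊆ l.toFinset := by
    intro j hj
    have := key (k - j)
    rw [Finset.mem_range] at hj
    rw [List.mem_toFinset]
    convert this using 1
    omega
  have := (Finset.card_le_card this).trans l.toFinset_card_le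
  simpa using this

theorem finite_isCatalanList (n : ℕ) : {l | IsCatalanList l ∧ l.length = n}.Finite := by
  refine ((Set.finite_Iic (fun _ : Fin n => n)).image List.ofFn).subset ?_
  rintro l ⟨h, rfl⟩
  exact ⟨l.get, fun i => (h.lt_length (l.get_mem i)).le, List.ofFn_get l⟩

/-- The Catalan words of length `n`. -/
noncomputable def catalanLists (n : ℕ) : Finset (List ℕ) := (finite_isCatalanList n).toFinset

theorem mem_catalanLists {n : ℕ} {l : List ℕ} :
    l ∈ catalanLists n ↔ IsCatalanList l ∧ l.length = n := by
  simp [catalanLists]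

/-- The number of Catalan words of length `n` with `m` zeros. -/
noncomputable def zerosCount (n m : ℕ) : ℕ := {l ∈ catalanLists n | l.count 0 = m}.card

theorem zerosCount_self (n : ℕ) : zerosCount n n = 1 := by
  rw [zerosCount, Finset.card_eq_one]
  refine ⟨List.replicate n 0, ?_⟩
  ext l
  rw [Finset.mem_filter, mem_catalanLists, Finset.mem_singleton]
  constructor
  · rintro ⟨⟨-, h1⟩, h2⟩
    have := length_eq_count_add_length_lower l
    have h0 : lower l = [] := List.length_eq_zero_iff.1 (by omega)
    rw [eq_replicate_of_lower_eq_nil h0, h1]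
  · rintro rfl
    exact ⟨⟨isCatalanList_replicate n, by simp⟩, by simp⟩

theorem zerosCount_of_lt {n m : ℕ} (h : n < m) : zerosCount n m = 0 := by
  rw [zerosCount, Finset.card_eq_zero, Finset.filter_eq_empty_iff]
  intro l hl
  have := (mem_catalanLists.1 hl).2
  have := l.count_le_length (a := 0)
  omega

theorem zerosCount_zero_right (n : ℕ) : zerosCount (n + 1) 0 = 0 := by
  rw [zerosCount, Finset.card_eq_zero, Finset.filter_eq_empty_iff]
  intro l hl
  obtain ⟨h1, h2⟩ := mem_catalanLists.1 hl
  rcases l with _ | ⟨a, l⟩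
  · simp at h2
  · obtain rfl := h1.head_eq_zero
    simp

theorem zerosCount_add_card (n m : ℕ) :
    zerosCount (n + 1 + (m + 1)) (m + 1) + (catalanLists (n + 1)).card =
      ∑ b ∈ catalanLists (n + 1), (b.count 0 + 1).multichoose m := by
  rw [zerosCount, Finset.card_eq_sum_card_fiberwise (f := lower) (t := catalanLists (n + 1)),
    Finset.card_eq_sum_ones, ← Finset.sum_add_distrib]
  · refine Finset.sum_congr rfl fun b hb => ?_
    obtain ⟨h1, h2⟩ := mem_catalanLists.1 hb
    have hne : b ≠ [] := by rintro rfl; simp at h2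
    have := encard_isCatalanList_fiber h1 hne m
    rw [← Nat.cast_inj (R := ℕ∞), ← this, Nat.cast_add, Nat.cast_one,
      ← Set.encard_coe_eq_coe_finsetCard]
    congr 2
    ext l
    simp only [Finset.coe_filter, Finset.mem_filter, mem_catalanLists, Set.mem_ofPred_eq]
    have := length_eq_count_add_length_lower l
    constructor
    · tauto
    · rintro ⟨h3, h4, rfl⟩
      exact ⟨⟨⟨h3, by omega⟩, h4⟩, rfl⟩
  · intro l hl
    simp only [Finset.coe_filter, mem_catalanLists, Set.mem_ofPred_eq] at hl
    have := length_eq_count_add_length_lower l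
    rw [Finset.mem_coe, mem_catalanLists]
    exact ⟨isCatalanList_lower hl.1.1, by omega⟩

theorem sum_catalanLists {R : Type*} [Semiring R] (g : ℕ → R) {n K : ℕ} (hK : n < K) :
    ∑ l ∈ catalanLists (n + 1), g (l.count 0) =
      ∑ m ∈ Finset.range K, zerosCount (n + 1) (m + 1) * g (m + 1) := by
  have h : ∀ l ∈ catalanLists (n + 1), l.count 0 ∈ Finset.range (K + 1) := by
    intro l hl
    have := (mem_catalanLists.1 hl).2
    have := l.count_le_length (a := 0)
    rw [Finset.mem_range]
    omega
  rw [← Finset.sum_fiberwise_of_maps_to h, Finset.sum_range_succ']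
  have h0 : ∀ m, ∑ l ∈ catalanLists (n + 1) with l.count 0 = m, g (l.count 0) =
      zerosCount (n + 1) m * g m := by
    intro m
    rw [Finset.sum_congr rfl (g := fun _ => g m)]
    · simp [zerosCount]
    · intro l hl
      rw [(Finset.mem_filter.1 hl).2]
  simp [h0, zerosCount_zero_right]

open PowerSeries in
/-- The Catalan generating function with integer coefficients. -/
noncomputable def catalanInt : PowerSeries ℤ := catalanSeries.map (Nat.castRingHom ℤ)

open PowerSeries in
theorem catalanInt_eq : catalanInt = 1 + X * catalanInt ^ 2 := by
  have := congrArg (map (Nat.castRingHom ℤ)) catalanSeries_sq_mul_X_add_one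
  simp only [map_add, map_mul, map_pow, map_X, map_one] at this
  change catalanInt ^ 2 * X + 1 = catalanInt at this
  linear_combination -this

open PowerSeries in
theorem coeff_catalanInt (n : ℕ) : coeff n catalanInt = catalan n := by
  simp [catalanInt]

open PowerSeries in
theorem constantCoeff_catalanInt : constantCoeff catalanInt = 1 := by
  rw [← coeff_zero_eq_constantCoeff_apply, coeff_catalanInt]
  simp

open PowerSeries in
theorem X_pow_dvd_sub_sum_multichoose (r K : ℕ) :
    (X : PowerSeries ℤ) ^ (K + 1) ∣ X * catalanInt ^ (r + 1) -
      ∑ m ∈ Finset.range K, ((m + 1).multichoose r : PowerSeries ℤ) *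
        (X ^ (m + 1) * catalanInt ^ m) := by
  have hC := catalanInt_eq
  induction r with
  | zero =>
    refine ⟨catalanInt ^ (K + 1), ?_⟩
    induction K with
    | zero => simp
    | succ K ih =>
      rw [Finset.sum_range_succ, ← sub_sub, ih]
      simp only [Nat.multichoose_zero_right, Nat.cast_one]
      linear_combination X ^ (K + 1) * catalanInt ^ K * hC
  | succ r ih =>
    set S : ℕ → ℕ → PowerSeries ℤ := fun r K => ∑ m ∈ Finset.range K,
      ((m + 1).multichoose r : PowerSeries ℤ) * (X ^ (m + 1) * catalanInt ^ m) with hS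
    have key : ∀ K, S r K = (1 - X * catalanInt) * S (r + 1) K +
        (K.multichoose (r + 1) : PowerSeries ℤ) * (X ^ (K + 1) * catalanInt ^ K) := by
      intro K
      induction K with
      | zero => simp [hS]
      | succ K ih =>
        have h1 : ∀ r, S r (K + 1) = S r K + ((K + 1).multichoose r : PowerSeries ℤ) *
            (X ^ (K + 1) * catalanInt ^ K) := fun r => Finset.sum_range_succ _ _
        rw [h1, h1, ih, Nat.multichoose_succ_succ]
        push_cast
        ring
    obtain ⟨Q, hQ⟩ := ih
    change _ - S r K = _ at hQ
    change _ ∣ _ - S (r + 1) K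
    refine ⟨catalanInt * Q + K.multichoose (r + 1) * catalanInt ^ (K + 1), ?_⟩
    linear_combination catalanInt * hQ + catalanInt * key K + S (r + 1) K * hC

open PowerSeries in
theorem zerosCount_eq_coeff (n m : ℕ) :
    (zerosCount n (m + 1) : ℤ) = coeff n (X ^ (m + 1) * catalanInt ^ m) := by
  induction n using Nat.strong_induction_on generalizing m with
  | _ n ih =>
    rcases lt_trichotomy n (m + 1) with h | rfl | h
    · rw [zerosCount_of_lt h, coeff_X_pow_mul', if_neg (by omega)]
      rfl
    · rw [zerosCount_self, coeff_X_pow_mul', if_pos le_rfl]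
      simp [constantCoeff_catalanInt]
    · obtain ⟨d, rfl⟩ : ∃ d, n = d + 1 + (m + 1) := ⟨n - (m + 1) - 1, by omega⟩
      have moment : ∀ r, ((∑ b ∈ catalanLists (d + 1), (b.count 0).multichoose r : ℕ) : ℤ) =
          coeff (d + 1) (X * catalanInt ^ (r + 1)) := by
        intro r
        have h1 := X_pow_dvd_iff.1 (X_pow_dvd_sub_sum_multichoose r (d + 1))
          (d + 1) (by omega)
        rw [map_sub, sub_eq_zero] at h1
        rw [h1, map_sum, sum_catalanLists (fun i => i.multichoose r) (Nat.lt_succ_self d)]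
        push_cast
        refine Finset.sum_congr rfl fun i _ => ?_
        rw [ih _ (by omega), mul_comm, ← nsmul_eq_mul, ← nsmul_eq_mul, map_nsmul]
      have shifted : ∀ m, ((∑ b ∈ catalanLists (d + 1), (b.count 0 + 1).multichoose m : ℕ) : ℤ) =
          coeff (d + 1) (catalanInt ^ m + X * catalanInt) := by
        intro m
        induction m with
        | zero => simpa [coeff_one] using moment 0
        | succ m ihm =>
          simp only [Nat.multichoose_succ_succ, Finset.sum_add_distrib]
          rw [Nat.cast_add, moment, ihm, ← map_add]
          congr 1
          linear_combination - catalanInt ^ m * catalanInt_eq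
      have h2 := zerosCount_add_card d m
      have h3 := moment 0
      simp only [Nat.multichoose_zero_right, Finset.sum_const, smul_eq_mul, mul_one, zero_add,
        pow_one] at h3
      have h4 := shifted m
      rw [← h2, Nat.cast_add, h3, map_add] at h4
      rw [coeff_X_pow_mul]
      linarith

/-- The number of Catalan words of length `n` with an odd number of zeros. -/
noncomputable def oddCount (n : ℕ) : ℕ := {l ∈ catalanLists n | Odd (l.count 0)}.card

theorem oddCount_zero : oddCount 0 = 0 := by
  rw [oddCount, Finset.card_eq_zero, Finset.filter_eq_empty_iff]
  intro l hl
  rw [List.length_eq_zero_iff.1 (mem_catalanLists.1 hl).2]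
  simp

open PowerSeries in
theorem X_pow_dvd_sum_odd (k : ℕ) :
    (X : PowerSeries ℤ) ^ (2 * k + 1) ∣ (1 + X * catalanInt) *
      (∑ m ∈ Finset.range (2 * k), (if Odd (m + 1) then 1 else 0) *
        (X ^ (m + 1) * catalanInt ^ m)) - X * catalanInt := by
  refine ⟨- catalanInt ^ (2 * k + 1), ?_⟩
  induction k with
  | zero => simp
  | succ k ih =>
    rw [show 2 * (k + 1) = 2 * k + 1 + 1 by ring, Finset.sum_range_succ, Finset.sum_range_succ,
      if_pos (by simp), if_neg (by simp [parity_simps])]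
    linear_combination ih -
      X ^ (2 * k + 1) * catalanInt ^ (2 * k) * (1 + X * catalanInt) * catalanInt_eq

open PowerSeries in
theorem oddCount_series :
    (1 + X * catalanInt) * PowerSeries.mk (fun n => (oddCount n : ℤ)) = X * catalanInt := by
  have hodd (k : ℕ) : (X : PowerSeries ℤ) ^ (2 * k + 1) ∣
      PowerSeries.mk (fun n => (oddCount n : ℤ)) -
      ∑ m ∈ Finset.range (2 * k), (if Odd (m + 1) then 1 else 0) *
        (X ^ (m + 1) * catalanInt ^ m) := by
    rw [X_pow_dvd_iff]
    intro j hj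
    rw [map_sub, sub_eq_zero, coeff_mk, map_sum]
    cases j with
    | zero =>
      rw [Finset.sum_eq_zero fun m _ => by split_ifs <;> simp]
      simp [oddCount_zero]
    | succ i =>
      have := sum_catalanLists (fun m => if Odd m then (1 : ℤ) else 0) (show i < 2 * k by omega)
      rw [← Finset.sum_filter, Finset.sum_const, nsmul_eq_mul, mul_one] at this
      rw [oddCount, this]
      refine Finset.sum_congr rfl fun m _ => ?_
      rw [zerosCount_eq_coeff]
      split_ifs <;> simp
  ext n
  have h := dvd_add ((hodd n).mul_left (1 + X * catalanInt)) (X_pow_dvd_sum_odd n)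
  rw [← sub_eq_zero, ← map_sub]
  refine X_pow_dvd_iff.1 ?_ n (show n < 2 * n + 1 by omega)
  convert h using 1
  ring

open PowerSeries in
theorem oddCount_recurrence (n : ℕ) :
    oddCount (n + 1) + ∑ p ∈ Finset.HasAntidiagonal.antidiagonal n, catalan p.1 * oddCount p.2 =
      catalan n := by
  have h := congrArg (coeff (n + 1)) oddCount_series
  rw [add_mul, one_mul, mul_assoc, map_add, coeff_succ_X_mul, coeff_succ_X_mul, coeff_mul,
    coeff_mk, coeff_catalanInt] at h
  simp only [coeff_mk, coeff_catalanInt] at h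
  exact_mod_cast h

theorem isCatalanWord_iff {n : ℕ} (a : Fin n → ℕ) :
    IsCatalanWord a ↔ IsCatalanList (List.ofFn a) := by
  refine and_congr ?_ ⟨fun h k u v huv hk => ?_, fun h i hi hmin => ?_⟩
  · simp [NoDrop, List.isChain_iff_getElem]
  · have hlen : n = u.length + 1 + v.length := by
      have := congrArg List.length huv
      simp at this
      omega
    have hget : ∀ i : Fin n, (List.ofFn a)[(i : ℕ)]'(by simp) = a i := by simp
    simp only [huv] at hget
    have hlt : u.length < n := by omega
    have hu : a ⟨u.length, hlt⟩ = k + 1 := by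
      rw [← hget]
      simp
    obtain ⟨⟨i₁, h1, h1'⟩, ⟨i₂, h2, h2'⟩⟩ := h ⟨u.length, hlt⟩ (by omega) (by
      intro j hj
      by_contra hlt'
      have hj' : (j : ℕ) < u.length := Fin.lt_def.1 (not_le.1 hlt')
      apply hk
      rw [← hu, ← hj, ← hget, List.getElem_append_left hj']
      exact List.getElem_mem _)
    rw [hu] at h1' h2'
    rw [Fin.lt_def] at h1 h2
    simp only at h1 h2
    constructor
    · rw [show k = a i₁ by omega, ← hget, List.getElem_append_left h1]
      exact List.getElem_mem _
    · have hmem := List.getElem_mem (l := v) (n := i₂ - u.length - 1) (by omega)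
      convert hmem using 1
      rw [show k = a i₂ by omega, ← hget, List.getElem_append_right h2.le, List.getElem_cons,
        dif_neg (by omega)]
  · obtain ⟨k, hk⟩ : ∃ k, a i = k + 1 := ⟨a i - 1, by omega⟩
    have hi' : (i : ℕ) < (List.ofFn a).length := by simp
    have hsplit : List.ofFn a = (List.ofFn a).take i ++ (k + 1) :: (List.ofFn a).drop (i + 1) := by
      conv_lhs => rw [← List.take_append_drop i (List.ofFn a), List.drop_eq_getElem_cons hi']
      simp [hk]
    obtain ⟨h1, h2⟩ := h k _ _ hsplit (by
      intro hmem
      obtain ⟨j, hj, hj'⟩ := List.mem_take_iff_getElem.1 hmem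
      have hjn : j < n := by simp at hj; omega
      have := hmin ⟨j, hjn⟩ (by simpa [hk] using hj')
      rw [Fin.le_def] at this
      simp at this hj
      omega)
    constructor
    · obtain ⟨j, hj, hj'⟩ := List.mem_take_iff_getElem.1 h1
      simp at hj hj'
      exact ⟨⟨j, by omega⟩, by rw [Fin.lt_def]; exact hj, by omega⟩
    · obtain ⟨j, hj, hj'⟩ := List.mem_drop_iff_getElem.1 h2
      simp at hj hj'
      exact ⟨⟨i + 1 + j, by omega⟩, by rw [Fin.lt_def]; simp; omega, by omega⟩

theorem countEq_eq_count {n : ℕ} (a : Fin n → ℕ) (c : ℕ) :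
    countEq a c = (List.ofFn a).count c := by
  rw [countEq, ← Finset.coe_filter_univ, Set.ncard_coe_finset, ← Multiset.coe_count,
    ← Fin.univ_val_map, Multiset.count_map, Finset.card_def, Finset.filter_val]
  simp only [eq_comm]

theorem oZ_eq_oddCount (n : ℕ) : oZ n = oddCount n := by
  rw [oZ, oddCount, ← Set.ncard_image_of_injective _ List.ofFn_injective, ← Set.ncard_coe_finset]
  congr 1
  ext l
  simp only [Set.mem_image, Set.mem_ofPred_eq, isCatalanWord_iff, countEq_eq_count,
    Finset.coe_filter, mem_catalanLists]
  constructor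
  · rintro ⟨a, ⟨h1, h2⟩, rfl⟩
    exact ⟨⟨h1, by simp⟩, h2⟩
  · rintro ⟨⟨h1, rfl⟩, h2⟩
    exact ⟨l.get, by simpa using ⟨h1, h2⟩, by simp⟩

theorem summable_catalan {x : ℝ} (hx0 : 0 < x) (hx : x < 1 / 4) :
    Summable fun n : ℕ => (catalan n : ℝ) * x ^ n := by
  have hg : Summable fun n : ℕ => (4 * x) ^ n :=
    summable_geometric_of_lt_one (by positivity) (by linarith)
  refine hg.of_nonneg_of_le (fun n => by positivity) fun n => ?_
  rw [mul_pow]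
  gcongr
  have h1 : catalan n ≤ n.centralBinom := by
    rw [catalan_eq_centralBinom_div]
    exact Nat.div_le_self _ _
  exact_mod_cast h1.trans n.centralBinom_le_four_pow

theorem sum_antidiagonal_mul_pow (f g : ℕ → ℝ) (x : ℝ) (n : ℕ) :
    ∑ p ∈ Finset.HasAntidiagonal.antidiagonal n, f p.1 * x ^ p.1 * (g p.2 * x ^ p.2) =
      (∑ p ∈ Finset.HasAntidiagonal.antidiagonal n, f p.1 * g p.2) * x ^ n := by
  rw [Finset.sum_mul]
  refine Finset.sum_congr rfl fun p hp => ?_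
  rw [← Finset.HasAntidiagonal.mem_antidiagonal.1 hp, pow_add]
  ring

theorem tsum_catalan_eq {x : ℝ} (hx0 : 0 < x) (hx : x < 1 / 4) :
    ∑' n : ℕ, (catalan n : ℝ) * x ^ n = 1 + x * (∑' n : ℕ, (catalan n : ℝ) * x ^ n) ^ 2 := by
  have hs := summable_catalan hx0 hx
  rw [sq, tsum_mul_tsum_eq_tsum_sum_antidiagonal_of_summable_norm hs.norm hs.norm, ← tsum_mul_left,
    hs.tsum_eq_zero_add]
  simp only [catalan_zero, Nat.cast_one, pow_zero, mul_one]
  congr 2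
  ext n
  rw [sum_antidiagonal_mul_pow (fun n => (catalan n : ℝ)) (fun n => (catalan n : ℝ)), catalan_succ']
  push_cast
  ring

theorem two_mul_mul_Cfun {x : ℝ} (hx0 : 0 < x) : 2 * x * Cfun x = 1 - √(1 - 4 * x) := by
  rw [Cfun]
  field_simp

theorem Cfun_eq {x : ℝ} (hx0 : 0 < x) (hx : x < 1 / 4) : Cfun x = 1 + x * Cfun x ^ 2 := by
  have h := two_mul_mul_Cfun hx0
  have hs := Real.sq_sqrt (show 0 ≤ 1 - 4 * x by linarith)
  have h2 : √(1 - 4 * x) = 1 - 2 * x * Cfun x := by linarith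
  rw [h2] at hs
  have : 4 * x * (Cfun x - (1 + x * Cfun x ^ 2)) = 0 := by linarith
  have := (mul_eq_zero.1 this).resolve_left (by positivity)
  linarith

theorem sum_range_catalan_le {x : ℝ} (hx0 : 0 < x) (hx : x < 1 / 4) (N : ℕ) :
    ∑ n ∈ Finset.range N, (catalan n : ℝ) * x ^ n ≤ Cfun x := by
  have hC : 0 ≤ Cfun x := by rw [Cfun_eq hx0 hx]; positivity
  induction N with
  | zero => simpa using hC
  | succ N ih =>
    rw [Finset.sum_range_succ', Cfun_eq hx0 hx, add_comm]
    simp only [catalan_zero, Nat.cast_one, pow_zero, mul_one]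
    have hle : ∑ n ∈ Finset.range N, (catalan (n + 1) : ℝ) * x ^ (n + 1) ≤
        x * (∑ n ∈ Finset.range N, (catalan n : ℝ) * x ^ n) ^ 2 := by
      rw [sq, Finset.sum_mul_sum, ← Finset.sum_product', Finset.mul_sum]
      refine le_trans (le_of_eq ?_) (Finset.sum_fiberwise_le_sum_of_sum_fiber_nonneg
        (t := Finset.range N) (g := fun p : ℕ × ℕ => p.1 + p.2)
        fun y _ => Finset.sum_nonneg fun p _ => by positivity)
      refine Finset.sum_congr rfl fun n hn => ?_
      rw [← Finset.mul_sum, catalan_succ', pow_succ', mul_left_comm, Nat.cast_sum]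
      simp only [Nat.cast_mul]
      rw [← sum_antidiagonal_mul_pow (fun n => (catalan n : ℝ)) (fun n => (catalan n : ℝ))]
      congr 2
      ext ⟨i, j⟩
      simp only [Finset.HasAntidiagonal.mem_antidiagonal, Finset.mem_filter, Finset.mem_product,
        Finset.mem_range] at hn ⊢
      omega
    have h0 : 0 ≤ ∑ n ∈ Finset.range N, (catalan n : ℝ) * x ^ n :=
      Finset.sum_nonneg fun n _ => by positivity
    gcongr
    exact hle.trans (by gcongr)

theorem tsum_catalan {x : ℝ} (hx0 : 0 < x) (hx : x < 1 / 4) :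
    ∑' n : ℕ, (catalan n : ℝ) * x ^ n = Cfun x := by
  have h1 := tsum_catalan_eq hx0 hx
  have h2 := Cfun_eq hx0 hx
  have h3 : ∑' n : ℕ, (catalan n : ℝ) * x ^ n ≤ Cfun x :=
    Real.tsum_le_of_sum_range_le (fun n => by positivity) (sum_range_catalan_le hx0 hx)
  set S := ∑' n : ℕ, (catalan n : ℝ) * x ^ n
  have h4 := two_mul_mul_Cfun hx0
  have h5 : 0 < √(1 - 4 * x) := Real.sqrt_pos.2 (by linarith)
  have h6 : (Cfun x - S) * (1 - x * (Cfun x + S)) = 0 := by linear_combination h2 - h1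
  rcases mul_eq_zero.1 h6 with h | h
  · linarith
  · nlinarith

theorem oddCount_succ_le (n : ℕ) : oddCount (n + 1) ≤ catalan n := by
  have := oddCount_recurrence n
  omega

theorem summable_oddCount {x : ℝ} (hx0 : 0 < x) (hx : x < 1 / 4) :
    Summable fun n : ℕ => (oddCount n : ℝ) * x ^ n := by
  rw [← summable_nat_add_iff 1]
  refine ((summable_catalan hx0 hx).mul_left x).of_nonneg_of_le (fun n => by positivity) fun n => ?_
  have : (oddCount (n + 1) : ℝ) ≤ catalan n := by exact_mod_cast oddCount_succ_le n
  calc _ ≤ (catalan n : ℝ) * x ^ (n + 1) := by gcongr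
    _ = _ := by ring

theorem tsum_oddCount {x : ℝ} (hx0 : 0 < x) (hx : x < 1 / 4) :
    (1 + x * Cfun x) * ∑' n : ℕ, (oddCount n : ℝ) * x ^ n = x * Cfun x := by
  have hs := summable_catalan hx0 hx
  have ho := summable_oddCount hx0 hx
  have hco := summable_norm_sum_mul_antidiagonal_of_summable_norm hs.norm ho.norm
  rw [add_mul, one_mul, mul_assoc, ← tsum_catalan hx0 hx,
    tsum_mul_tsum_eq_tsum_sum_antidiagonal_of_summable_norm hs.norm ho.norm, ho.tsum_eq_zero_add,
    oddCount_zero, ← tsum_mul_left, ← tsum_mul_left, Nat.cast_zero, zero_mul, zero_add,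
    ← ((summable_nat_add_iff 1).2 ho).tsum_add (hco.of_norm.mul_left x)]
  congr 1
  ext n
  rw [sum_antidiagonal_mul_pow (fun n => (catalan n : ℝ)) (fun n => (oddCount n : ℝ)),
    ← oddCount_recurrence n]
  push_cast
  ring

/-- `Σ_{n≥1} oₙ xⁿ = x/(1 - x²C(x)²) = (1-√(1-4x))/(3-√(1-4x))` for `0 < x < 1/4`.
(The term for `n = 0` vanishes, since the empty word has zero—an even number of—zeros.) -/
theorem odd_zeros_gf (x : ℝ) (hx0 : 0 < x) (hx : x < 1/4) :
    Summable (fun n : ℕ => (oZ n : ℝ) * x ^ n) ∧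
    ∑' n : ℕ, (oZ n : ℝ) * x ^ n = x / (1 - x ^ 2 * (Cfun x) ^ 2) ∧
    x / (1 - x ^ 2 * (Cfun x) ^ 2) =
      (1 - Real.sqrt (1 - 4 * x)) / (3 - Real.sqrt (1 - 4 * x)) := by
  have h1 := two_mul_mul_Cfun hx0
  have h2 := Cfun_eq hx0 hx
  have h3 := tsum_oddCount hx0 hx
  have hs : 0 < √(1 - 4 * x) := Real.sqrt_pos.2 (by linarith)
  have hs1 : √(1 - 4 * x) < 1 := by
    rw [Real.sqrt_lt' one_pos]
    linarith
  have hy : x * Cfun x = (1 - √(1 - 4 * x)) / 2 := by linarith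
  have hgf : x / (1 - x ^ 2 * (Cfun x) ^ 2) =
      (1 - Real.sqrt (1 - 4 * x)) / (3 - Real.sqrt (1 - 4 * x)) := by
    have hx' : x = (1 - √(1 - 4 * x)) * (1 + √(1 - 4 * x)) / 4 := by
      linear_combination (1 / 4) * Real.sq_sqrt (show 0 ≤ 1 - 4 * x by linarith)
    rw [← mul_pow, hy, div_eq_div_iff (by nlinarith) (by linarith)]
    linear_combination (3 - √(1 - 4 * x)) * hx'
  simp only [oZ_eq_oddCount]
  refine ⟨summable_oddCount hx0 hx, ?_, hgf⟩
  rw [hgf, eq_div_iff (by linarith)]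
  rw [hy] at h3
  linear_combination 2 * h3
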